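/- arXiv:2503.13922 — 2 statements merged into one kernel-verified Lean document; each statement's English description precedes it below -/
import Mathlib

section
/- (Benilan–Crandall inequality, unsigned case.) Let u be a classical solution of the regularized problem and suppose there is θ > 0 with ρ_λ(x)·g(x) ≥ −θ for all x ∈ [a,b]. Then ∂_t u(t,x) ≥ −(θ + θ/(exp(θ·t) − 1))·(u(t,x) + 1/n) for all (t,x) ∈ (0,T] × [a,b]. -/
open MeasureTheory Set

noncomputable def rho (lam x : ℝ) : ℝ := Real.sqrt x * (x + lam) * Real.sqrt (x + 2 * lam)

/-- `u` is a classical solution of the regularized Dirichlet problem on `[0,T] × [a,b]`: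
nonnegative, continuous, C¹ in time, C² in space, solving
`∂ₜu = ρ_λ(x)(u + 1/n)∂ₓ²u + ρ_λ(x) g(x) (u + 1/n)` with zero lateral boundary data
and initial data `u₀`. -/
structure IsRegSolution (lam a b T : ℝ) (n : ℕ) (g u₀ : ℝ → ℝ) (u : ℝ → ℝ → ℝ) : Prop where
  nonneg : ∀ t ∈ Icc (0:ℝ) T, ∀ x ∈ Icc a b, 0 ≤ u t x
  cont : ContinuousOn (fun p : ℝ × ℝ => u p.1 p.2) (Icc (0:ℝ) T ×ˢ Icc a b)
  diff_t : ∀ t ∈ Icc (0:ℝ) T, ∀ x ∈ Icc a b, DifferentiableAt ℝ (fun s => u s x) t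
  diff_x : ∀ t ∈ Icc (0:ℝ) T, ∀ x ∈ Icc a b, DifferentiableAt ℝ (fun y => u t y) x
  diff_xx : ∀ t ∈ Icc (0:ℝ) T, ∀ x ∈ Icc a b, DifferentiableAt ℝ (deriv (fun y => u t y)) x
  cont_dt : ContinuousOn (fun p : ℝ × ℝ => deriv (fun s => u s p.2) p.1) (Icc (0:ℝ) T ×ˢ Icc a b)
  cont_dx : ContinuousOn (fun p : ℝ × ℝ => deriv (fun y => u p.1 y) p.2) (Icc (0:ℝ) T ×ˢ Icc a b)
  cont_dxx : ContinuousOn (fun p : ℝ × ℝ => deriv (deriv (fun y => u p.1 y)) p.2) (Icc (0:ℝ) T ×ˢ Icc a b)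
  eqn : ∀ t ∈ Icc (0:ℝ) T, ∀ x ∈ Ioo a b,
    deriv (fun s => u s x) t =
      rho lam x * (u t x + 1 / (n:ℝ)) * deriv (deriv (fun y => u t y)) x
        + rho lam x * g x * (u t x + 1 / (n:ℝ))
  bdry_a : ∀ t ∈ Icc (0:ℝ) T, u t a = 0
  bdry_b : ∀ t ∈ Icc (0:ℝ) T, u t b = 0
  init : ∀ x ∈ Icc a b, u 0 x = u₀ x

/-- A function that is nonnegative to the left of a zero has nonpositive derivative there. -/
lemma HasDerivAt.nonpos_of_nonneg_left {f : ℝ → ℝ} {f' s t : ℝ} (hst : s < t)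
    (hf : HasDerivAt f f' t) (hpos : ∀ r ∈ Ioo s t, f t ≤ f r) : f' ≤ 0 := by
  have h := (hasDerivWithinAt_iff_tendsto_slope' (by simp)).1 (hf.hasDerivWithinAt (s := Iio t))
  refine le_of_tendsto h ?_
  filter_upwards [Ioo_mem_nhdsLT hst] with r hr
  rw [slope_def_field]
  exact div_nonpos_of_nonneg_of_nonpos (by linarith [hpos r hr]) (by linarith [hr.2])

/-- A function that stays below its value to the right of a point has nonpositive derivative. -/
lemma HasDerivAt.nonpos_of_le_right {f : ℝ → ℝ} {f' t : ℝ}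
    (hf : HasDerivAt f f' t) (hle : ∀ r, t < r → f r ≤ f t) : f' ≤ 0 := by
  have h := (hasDerivWithinAt_iff_tendsto_slope' (by simp)).1 (hf.hasDerivWithinAt (s := Ioi t))
  refine le_of_tendsto h ?_
  filter_upwards [self_mem_nhdsWithin] with r hr
  rw [slope_def_field]
  exact div_nonpos_of_nonpos_of_nonneg (by linarith [hle r hr]) (by linarith [mem_Ioi.1 hr])

/-- Necessary second-order condition at a local minimum. -/
lemma IsLocalMin.deriv_deriv_nonneg {f : ℝ → ℝ} {x : ℝ} (hmin : IsLocalMin f x)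
    (hf : ContinuousAt f x) : 0 ≤ deriv (deriv f) x := by
  by_contra! hneg
  have hmax := isLocalMax_of_deriv_deriv_neg hneg hmin.deriv_eq_zero hf
  have hconst : f =ᶠ[nhds x] fun _ => f x := by
    filter_upwards [hmin, hmax] with y h₁ h₂ using le_antisymm h₂ h₁
  have h := hconst.deriv.deriv_eq
  simp at h
  linarith

lemma rho_nonneg {lam x : ℝ} (hlam : 0 ≤ lam) (hx : 0 ≤ x) : 0 ≤ rho lam x := by
  unfold rho
  positivity

/-- The solution of `α' = β α (α - 1)` with `α 0 = 1 / (1 + c)`. -/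
noncomputable def timeScale (β c t : ℝ) : ℝ := (1 + c * Real.exp (β * t))⁻¹

/-- The primitive of `timeScale β c` vanishing at `0`. -/
noncomputable def timeChange (β c t : ℝ) : ℝ :=
  t - (Real.log (1 + c * Real.exp (β * t)) - Real.log (1 + c)) / β

section TimeChange

variable {β c : ℝ}

lemma one_add_mul_exp_pos (hc : 0 ≤ c) (t : ℝ) : 0 < 1 + c * Real.exp (β * t) := by
  positivity

lemma timeScale_pos (hc : 0 ≤ c) (t : ℝ) : 0 < timeScale β c t :=
  inv_pos.2 (one_add_mul_exp_pos hc t)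

lemma timeScale_lt_one (hc : 0 < c) (t : ℝ) : timeScale β c t < 1 :=
  inv_lt_one_of_one_lt₀ (by have := mul_pos hc (Real.exp_pos (β * t)); linarith)

lemma timeChange_zero : timeChange β c 0 = 0 := by simp [timeChange]

lemma hasDerivAt_one_add_mul_exp (t : ℝ) :
    HasDerivAt (fun s => 1 + c * Real.exp (β * s)) (c * (Real.exp (β * t) * β)) t := by
  have h : HasDerivAt (fun s => β * s) β t := by simpa using (hasDerivAt_id t).const_mul β
  exact (h.exp.const_mul c).const_add 1

lemma hasDerivAt_timeScale (hc : 0 ≤ c) (t : ℝ) :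
    HasDerivAt (timeScale β c) (β * timeScale β c t * (timeScale β c t - 1)) t := by
  have h0 := (one_add_mul_exp_pos (β := β) hc t).ne'
  refine ((hasDerivAt_one_add_mul_exp t).inv h0).congr_deriv ?_
  unfold timeScale
  field_simp
  ring

lemma hasDerivAt_timeChange (hβ : 0 < β) (hc : 0 ≤ c) (t : ℝ) :
    HasDerivAt (timeChange β c) (timeScale β c t) t := by
  have h0 := (one_add_mul_exp_pos (β := β) hc t).ne'
  refine ((hasDerivAt_id t).sub ((((hasDerivAt_one_add_mul_exp t).log h0).sub_const
    (Real.log (1 + c))).div_const β)).congr_deriv ?_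
  unfold timeScale
  field_simp
  ring

lemma timeChange_le (hβ : 0 < β) (hc : 0 ≤ c) {t : ℝ} (ht : 0 ≤ t) : timeChange β c t ≤ t := by
  have h : Real.log (1 + c) ≤ Real.log (1 + c * Real.exp (β * t)) := by
    apply Real.log_le_log (by positivity)
    nlinarith [Real.one_le_exp (mul_nonneg hβ.le ht)]
  have := div_nonneg (sub_nonneg.2 h) hβ.le
  unfold timeChange
  linarith

lemma timeChange_nonneg (hβ : 0 < β) (hc : 0 ≤ c) {t : ℝ} (ht : 0 ≤ t) :
    0 ≤ timeChange β c t := by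
  have hmono : Monotone (timeChange β c) := monotone_of_deriv_nonneg
    (fun s => (hasDerivAt_timeChange hβ hc s).differentiableAt)
    (fun s => by rw [(hasDerivAt_timeChange hβ hc s).deriv]; exact (timeScale_pos hc s).le)
  simpa [timeChange_zero] using hmono ht

lemma timeChange_mem_Icc (hβ : 0 < β) (hc : 0 ≤ c) {t T : ℝ} (ht : t ∈ Icc 0 T) :
    timeChange β c t ∈ Icc 0 T :=
  ⟨timeChange_nonneg hβ hc ht.1, (timeChange_le hβ hc ht.1).trans ht.2⟩

end TimeChange

/-- The time-rescaled solution lies strictly below the solution itself. -/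
lemma IsRegSolution.timeScale_mul_lt {lam a b T θ β c : ℝ} {n : ℕ} {g u₀ : ℝ → ℝ}
    {u : ℝ → ℝ → ℝ} (hu : IsRegSolution lam a b T n g u₀ u) (hlam : 0 ≤ lam) (ha : 0 < a)
    (hn : 1 ≤ n) (hθ : 0 < θ) (hθβ : θ < β) (hc : 0 < c)
    (hglb : ∀ x ∈ Icc a b, -θ ≤ rho lam x * g x) :
    ∀ t ∈ Icc (0 : ℝ) T, ∀ x ∈ Icc a b,
      timeScale β c t * (u (timeChange β c t) x + 1 / (n : ℝ)) < u t x + 1 / (n : ℝ) := by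
  have hβ : 0 < β := hθ.trans hθβ
  have hε : 0 < 1 / (n : ℝ) := by positivity
  set ε : ℝ := 1 / (n : ℝ) with hεdef
  set α := timeScale β c with hα
  set τ := timeChange β c with hτ
  have hα0 : ∀ t, 0 < α t := timeScale_pos hc.le
  have hα1 : ∀ t, α t < 1 := timeScale_lt_one hc
  have hτm : ∀ t ∈ Icc (0 : ℝ) T, τ t ∈ Icc (0 : ℝ) T := fun t => timeChange_mem_Icc hβ hc.le
  have hαd : ∀ t, HasDerivAt α (β * α t * (α t - 1)) t := hasDerivAt_timeScale hc.le
  have hτd : ∀ t, HasDerivAt τ (α t) t := hasDerivAt_timeChange hβ hc.le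
  have hαc : Continuous α := continuous_iff_continuousAt.2 fun t => (hαd t).continuousAt
  have hτc : Continuous τ := continuous_iff_continuousAt.2 fun t => (hτd t).continuousAt
  set F : ℝ × ℝ → ℝ := fun p => (u p.1 p.2 + ε) - α p.1 * (u (τ p.1) p.2 + ε) with hF
  have hFc : ContinuousOn F (Icc (0 : ℝ) T ×ˢ Icc a b) := by
    have h : ContinuousOn (fun p : ℝ × ℝ => u (τ p.1) p.2) (Icc (0 : ℝ) T ×ˢ Icc a b) :=
      hu.cont.comp (f := fun p : ℝ × ℝ => (τ p.1, p.2))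
        ((hτc.comp continuous_fst).prodMk continuous_snd).continuousOn
        (fun p hp => ⟨hτm _ hp.1, hp.2⟩)
    exact (hu.cont.add continuousOn_const).sub
      ((hαc.comp continuous_fst).continuousOn.mul (h.add continuousOn_const))
  by_contra! hcon
  obtain ⟨t₁, ht₁, x₁, hx₁, h₁⟩ := hcon
  have hS : IsCompact ((Icc (0 : ℝ) T ×ˢ Icc a b) ∩ F ⁻¹' Iic 0) :=
    (isCompact_Icc.prod isCompact_Icc).of_isClosed_subset
      (hFc.preimage_isClosed_of_isClosed (isClosed_Icc.prod isClosed_Icc) isClosed_Iic)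
      inter_subset_left
  obtain ⟨⟨t, x⟩, ⟨⟨ht, hx⟩, hFtx⟩, hmin⟩ := hS.exists_isMinOn
    ⟨(t₁, x₁), ⟨⟨ht₁, hx₁⟩, by simp only [hF, mem_preimage, mem_Iic]; linarith⟩⟩
    continuous_fst.continuousOn
  simp only at ht hx
  simp only [mem_preimage, mem_Iic] at hFtx
  have hearly : ∀ s ∈ Icc (0 : ℝ) T, s < t → ∀ y ∈ Icc a b, 0 < F (s, y) := by
    intro s hs hst y hy
    by_contra! hle
    have := isMinOn_iff.1 hmin (s, y) ⟨⟨hs, hy⟩, hle⟩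
    simp only at this
    linarith
  have hbot : ∀ s, ∀ y, 0 ≤ u s y → u (τ s) y = u s y → 0 < F (s, y) := by
    intro s y h0 h
    simp only [hF, h]
    nlinarith [hα1 s, hα0 s]
  have htpos : 0 < t := by
    rcases ht.1.eq_or_lt with h | h
    · have := hbot t x (hu.nonneg t ht x hx) (by rw [← h, hτ, timeChange_zero])
      linarith
    · exact h
  have hxI : x ∈ Ioo a b := by
    refine ⟨lt_of_le_of_ne hx.1 fun h => ?_, lt_of_le_of_ne hx.2 fun h => ?_⟩
    · have := hbot t x (hu.nonneg t ht x hx)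
        (by rw [← h, hu.bdry_a t ht, hu.bdry_a _ (hτm t ht)])
      linarith
    · have := hbot t x (hu.nonneg t ht x hx)
        (by rw [h, hu.bdry_b t ht, hu.bdry_b _ (hτm t ht)])
      linarith
  have hutd := (hu.diff_t t ht x hx).hasDerivAt
  have huτd := (hu.diff_t (τ t) (hτm t ht) x hx).hasDerivAt
  have hFt := (hutd.add_const ε).sub ((hαd t).mul ((huτd.comp t (hτd t)).add_const ε))
  have hslice : ∀ y ∈ Icc a b, 0 ≤ F (t, y) := by
    intro y hy
    have hcont : ContinuousWithinAt (fun s => F (s, y)) (Ico 0 t) t := by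
      refine ContinuousWithinAt.comp (t := Icc (0 : ℝ) T ×ˢ Icc a b) (f := fun s => (s, y))
        (hFc (t, y) ⟨ht, hy⟩) (by fun_prop) ?_
      exact fun s hs => ⟨⟨hs.1, hs.2.le.trans ht.2⟩, hy⟩
    have hne : (nhdsWithin t (Ico 0 t)).NeBot := by
      rw [← mem_closure_iff_nhdsWithin_neBot, closure_Ico htpos.ne]
      exact right_mem_Icc.2 htpos.le
    refine ge_of_tendsto hcont ?_
    filter_upwards [self_mem_nhdsWithin] with s hs
    exact (hearly s ⟨hs.1, hs.2.le.trans ht.2⟩ hs.2 y hy).le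
  have hzero : F (t, x) = 0 := le_antisymm hFtx (hslice x hx)
  have hder := HasDerivAt.nonpos_of_nonneg_left htpos hFt (fun r hr => by
    have h := hearly r ⟨hr.1.le, hr.2.le.trans ht.2⟩ hr.2 x hx
    rw [← hzero] at h
    exact h.le)
  have hnear : ∀ᶠ y in nhds x, y ∈ Ioo a b := Ioo_mem_nhds hxI.1 hxI.2
  have hlmin : IsLocalMin (fun y => F (t, y)) x := by
    filter_upwards [hnear] with y hy
    rw [hzero]
    exact hslice y (Ioo_subset_Icc_self hy)
  have hdx : ∀ y ∈ Icc a b, HasDerivAt (fun y => F (t, y))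
      (deriv (fun y => u t y) y - α t * deriv (fun y => u (τ t) y) y) y := fun y hy =>
    ((hu.diff_x t ht y hy).hasDerivAt.add_const ε).sub
      (((hu.diff_x _ (hτm t ht) y hy).hasDerivAt.add_const ε).const_mul (α t))
  have hd : deriv (fun y => F (t, y)) =ᶠ[nhds x]
      fun y => deriv (fun y => u t y) y - α t * deriv (fun y => u (τ t) y) y := by
    filter_upwards [hnear] with y hy using (hdx y (Ioo_subset_Icc_self hy)).deriv
  have hdd : HasDerivAt
      (fun y => deriv (fun y => u t y) y - α t * deriv (fun y => u (τ t) y) y) _ x :=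
    (hu.diff_xx t ht x hx).hasDerivAt.sub
      ((hu.diff_xx _ (hτm t ht) x hx).hasDerivAt.const_mul (α t))
  have hconv := hlmin.deriv_deriv_nonneg (hdx x hx).continuousAt
  rw [hd.deriv_eq, hdd.deriv] at hconv
  rw [hu.eqn t ht x hxI, hu.eqn _ (hτm t ht) x hxI] at hder
  simp only [hF] at hzero
  have hV : 0 < u (τ t) x + ε := by linarith [hu.nonneg _ (hτm t ht) x hx]
  simp only [Function.comp_apply, ← hεdef] at hder
  rw [show u t x + ε = α t * (u (τ t) x + ε) by linarith] at hder
  generalize u (τ t) x + ε = V at hder hV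
  generalize deriv (deriv fun y => u t y) x = A at hder hconv
  generalize deriv (deriv fun y => u (τ t) y) x = B at hder hconv
  have hρ := rho_nonneg hlam (ha.trans hxI.1).le
  have hg := hglb x hx
  have h0 := hα0 t
  have h1 := hα1 t
  generalize α t = k at *
  have hpos : 0 < k * V * (rho lam x * (A - k * B) + (1 - k) * (rho lam x * g x + β)) := by
    have h2 : 0 < (1 - k) * (rho lam x * g x + β) := mul_pos (by linarith) (by linarith)
    have h3 := mul_nonneg hρ hconv
    exact mul_pos (mul_pos h0 hV) (by linarith)
  nlinarith

/-- Benilan–Crandall inequality, unsigned case: if `ρ_λ·g ≥ -θ` with `θ > 0`, then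
`∂ₜu(t,x) ≥ -(θ + θ/(exp(θt)-1))·(u(t,x)+1/n)` on `(0,T] × [a,b]`. -/
theorem benilan_crandall_unsigned
    (lam a b T : ℝ) (n : ℕ) (hlam : 0 ≤ lam) (ha : 0 < a) (hab : a < b) (hT : 0 < T)
    (hn : 1 ≤ n) (g u₀ : ℝ → ℝ) (hg : ContinuousOn g (Icc a b))
    (hu₀c : ContinuousOn u₀ (Icc a b)) (hu₀nn : ∀ x ∈ Icc a b, 0 ≤ u₀ x)
    (hu₀a : u₀ a = 0) (hu₀b : u₀ b = 0)
    (u : ℝ → ℝ → ℝ) (hu : IsRegSolution lam a b T n g u₀ u)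
    (θ : ℝ) (hθ : 0 < θ) (hglb : ∀ x ∈ Icc a b, -θ ≤ rho lam x * g x) :
    ∀ t ∈ Ioc (0:ℝ) T, ∀ x ∈ Icc a b,
      deriv (fun s => u s x) t
        ≥ -((θ + θ / (Real.exp (θ * t) - 1)) * (u t x + 1 / (n:ℝ))) := by
  intro t ht x hx
  have htI : t ∈ Icc (0 : ℝ) T := ⟨ht.1.le, ht.2⟩
  have key : ∀ β > θ, deriv (fun s => u s x) t
      ≥ -((β + β / (Real.exp (β * t) - 1)) * (u t x + 1 / (n:ℝ))) := by
    intro β hβθ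
    have hβ : 0 < β := hθ.trans hβθ
    have hE : 0 < Real.exp (β * t) - 1 := by
      have hβt := mul_pos hβ ht.1
      linarith [Real.add_one_lt_exp hβt.ne']
    set E := Real.exp (β * t) with hEdef
    have hlin : HasDerivAt (fun c : ℝ => 1 + c * E) E 0 := by
      simpa using ((hasDerivAt_id (0 : ℝ)).mul_const E).const_add 1
    have hlin' : HasDerivAt (fun c : ℝ => 1 + c) 1 0 := (hasDerivAt_id (0 : ℝ)).const_add 1
    have hα : HasDerivAt (fun c => timeScale β c t) (-E) 0 :=
      (hlin.inv (by simp)).congr_deriv (by simp)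
    have hτ : HasDerivAt (fun c => timeChange β c t) (-((E - 1) / β)) 0 :=
      ((((hlin.log (by simp)).sub (hlin'.log (by simp))).div_const β).const_sub t).congr_deriv
        (by simp)
    have hτ0 : timeChange β 0 t = t := by simp [timeChange]
    have hα0 : timeScale β 0 t = 1 := by simp [timeScale]
    have hut : HasDerivAt (fun s => u s x) (deriv (fun s => u s x) t) (timeChange β 0 t) := by
      rw [hτ0]
      exact (hu.diff_t t htI x hx).hasDerivAt
    have hprod := hα.mul ((hut.comp 0 hτ).add_const (1 / (n : ℝ)))
    have h := hprod.nonpos_of_le_right (fun c hc => by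
      have h := hu.timeScale_mul_lt hlam ha hn hθ hβθ hc hglb t htI x hx
      simpa [hτ0, hα0] using h.le)
    simp only [Function.comp_apply, hτ0, hα0] at h
    have hquot : β + β / (E - 1) = β * E / (E - 1) := by field_simp; ring
    rw [hquot, ge_iff_le, neg_le, div_mul_eq_mul_div, le_div_iff₀ hE]
    have h2 : 0 ≤ β * (E * (u t x + 1 / (n : ℝ)) + deriv (fun s => u s x) t * ((E - 1) / β)) :=
      mul_nonneg hβ.le (by linarith)
    have h3 : β * ((E - 1) / β) = E - 1 := by field_simp
    have h4 : β * (E * (u t x + 1 / (n : ℝ)) + deriv (fun s => u s x) t * ((E - 1) / β))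
      = β * E * (u t x + 1 / (n : ℝ)) + deriv (fun s => u s x) t * (β * ((E - 1) / β)) := by ring
    rw [h4, h3] at h2
    linarith
  have hcont : ContinuousAt
      (fun β : ℝ => -((β + β / (Real.exp (β * t) - 1)) * (u t x + 1 / (n:ℝ)))) θ := by
    have hne : Real.exp (θ * t) - 1 ≠ 0 := by
      have hθt := mul_pos hθ ht.1
      have hlt := Real.add_one_lt_exp hθt.ne'
      exact (by linarith : 0 < Real.exp (θ * t) - 1).ne'
    fun_prop (disch := assumption)
  refine le_of_tendsto (hcont.continuousWithinAt (s := Ioi θ)) ?_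
  filter_upwards [self_mem_nhdsWithin] with β hβ using key β hβ
end

section
/- Let u be a classical solution of the regularized problem, and suppose there is a function K : (0,T] → (0,∞) such that ∂_t u(t,x) ≥ −(u(t,x) + 1/n)/K(t) for all (t,x) ∈ (0,T] × (a,b). Then for every t ∈ (0,T], ∫_a^b |∂_x u(t,x)|² dx ≤ (1/K(t) + A) · ∫_a^b (u(t,x) + 1/n) dν_λ(x). -/
open MeasureTheory Set

lemma rho_pos {lam x : ℝ} (hlam : 0 ≤ lam) (hx : 0 < x) : 0 < rho lam x := by
  unfold rho
  positivity

lemma continuous_rho (lam : ℝ) : Continuous (rho lam) := by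
  unfold rho
  fun_prop

/-- Integration by parts for the Dirichlet energy of a C² function vanishing at the endpoints. -/
lemma integral_deriv_sq_eq_neg_integral_mul_deriv {a b : ℝ} (hab : a ≤ b) {f : ℝ → ℝ}
    (hf : ∀ x ∈ Icc a b, DifferentiableAt ℝ f x)
    (hf' : ∀ x ∈ Icc a b, DifferentiableAt ℝ (deriv f) x)
    (hf'' : ContinuousOn (deriv (deriv f)) (Icc a b)) (hfa : f a = 0) (hfb : f b = 0) :
    ∫ x in a..b, deriv f x ^ 2 = ∫ x in a..b, -(f x * deriv (deriv f) x) := by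
  have hI := uIcc_of_le hab
  have hcf' : ContinuousOn (deriv f) (uIcc a b) := fun x hx =>
    (hf' x (hI ▸ hx)).continuousAt.continuousWithinAt
  have h := intervalIntegral.integral_mul_deriv_eq_deriv_mul (u := f) (v := deriv f)
    (fun x hx => (hf x (hI ▸ hx)).hasDerivAt) (fun x hx => (hf' x (hI ▸ hx)).hasDerivAt)
    hcf'.intervalIntegrable (hI ▸ hf'').intervalIntegrable
  rw [intervalIntegral.integral_neg, h, hfa, hfb]
  simp [sq]

/-- Gradient bound from a Benilan–Crandall inequality: if
`∂ₜu(t,x) ≥ -(u(t,x)+1/n)/K(t)` on `(0,T] × (a,b)` with `K > 0`, then for every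
`t ∈ (0,T]`, `∫ |∂ₓu(t)|² dx ≤ (1/K(t) + A)·∫ (u(t)+1/n) dν_λ`. -/
theorem gradient_bound_from_benilan_crandall
    (lam a b T : ℝ) (n : ℕ) (hlam : 0 ≤ lam) (ha : 0 < a) (hab : a < b) (hT : 0 < T)
    (hn : 1 ≤ n) (g u₀ : ℝ → ℝ) (hg : ContinuousOn g (Icc a b))
    (hu₀c : ContinuousOn u₀ (Icc a b)) (hu₀nn : ∀ x ∈ Icc a b, 0 ≤ u₀ x)
    (hu₀a : u₀ a = 0) (hu₀b : u₀ b = 0)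
    (u : ℝ → ℝ → ℝ) (hu : IsRegSolution lam a b T n g u₀ u)
    (A : ℝ) (hA : IsLUB ((fun x => |rho lam x * g x|) '' Ioo a b) A)
    (K : ℝ → ℝ) (hKpos : ∀ t ∈ Ioc (0:ℝ) T, 0 < K t)
    (hBC : ∀ t ∈ Ioc (0:ℝ) T, ∀ x ∈ Ioo a b,
      deriv (fun s => u s x) t ≥ -((u t x + 1 / (n:ℝ)) / K t)) :
    ∀ t ∈ Ioc (0:ℝ) T,
      (∫ x in Ioo a b, (deriv (fun y => u t y) x) ^ 2)
        ≤ (1 / K t + A) * ∫ x in Ioo a b, (u t x + 1 / (n:ℝ)) / rho lam x := by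
  intro t ht
  have ht' : t ∈ Icc (0:ℝ) T := Ioc_subset_Icc_self ht
  have hK := hKpos t ht
  have hn0 : (0:ℝ) < 1 / n := one_div_pos.mpr (by exact_mod_cast hn)
  have hslice : MapsTo (fun x : ℝ => (t, x)) (Icc a b) (Icc (0:ℝ) T ×ˢ Icc a b) :=
    fun x hx => ⟨ht', hx⟩
  have hpair : ContinuousOn (fun x : ℝ => (t, x)) (Icc a b) := by fun_prop
  have hcu : ContinuousOn (u t) (Icc a b) := hu.cont.comp hpair hslice
  have hcdd : ContinuousOn (deriv (deriv (u t))) (Icc a b) := hu.cont_dxx.comp hpair hslice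
  have hρ : ∀ x ∈ Icc a b, rho lam x ≠ 0 := fun x hx =>
    (rho_pos hlam (ha.trans_le hx.1)).ne'
  have hcR : ContinuousOn (fun x => (1 / K t + A) * ((u t x + 1 / (n:ℝ)) / rho lam x))
      (Icc a b) :=
    continuousOn_const.mul ((hcu.add continuousOn_const).div (continuous_rho lam).continuousOn hρ)
  have hcL : ContinuousOn (fun x => -(u t x * deriv (deriv (u t)) x)) (Icc a b) :=
    (hcu.mul hcdd).neg
  have hI := uIcc_of_le hab.le
  rw [← integral_Ioc_eq_integral_Ioo, ← integral_Ioc_eq_integral_Ioo,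
    ← intervalIntegral.integral_of_le hab.le, ← intervalIntegral.integral_of_le hab.le,
    integral_deriv_sq_eq_neg_integral_mul_deriv hab.le (hu.diff_x t ht') (hu.diff_xx t ht') hcdd
      (hu.bdry_a t ht') (hu.bdry_b t ht'),
    ← intervalIntegral.integral_const_mul]
  refine intervalIntegral.integral_mono_on_of_le_Ioo hab.le
    (hI ▸ hcL).intervalIntegrable (hI ▸ hcR).intervalIntegrable fun x hx => ?_
  have hx' := Ioo_subset_Icc_self hx
  have hu0 := hu.nonneg t ht' x hx'
  have hρx := rho_pos hlam (ha.trans hx.1)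
  have hAx : |rho lam x * g x| ≤ A := hA.1 ⟨x, hx, rfl⟩
  have hw : 0 < u t x + 1 / (n:ℝ) := by linarith
  have hkey : -(rho lam x * deriv (deriv (u t)) x) ≤ 1 / K t + A := by
    have h := hBC t ht x hx
    rw [hu.eqn t ht' x hx] at h
    have h1 : -(1 / K t) ≤ rho lam x * deriv (deriv (u t)) x + rho lam x * g x := by
      refine le_of_mul_le_mul_right ?_ hw
      calc -(1 / K t) * (u t x + 1 / (n:ℝ)) = -((u t x + 1 / (n:ℝ)) / K t) := by ring
        _ ≤ _ := h
        _ = _ := by ring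
    linarith [le_abs_self (rho lam x * g x)]
  have hC : 0 ≤ 1 / K t + A := by linarith [abs_nonneg (rho lam x * g x), one_div_pos.mpr hK]
  rw [← mul_div_assoc, le_div_iff₀ hρx]
  calc -(u t x * deriv (deriv (u t)) x) * rho lam x
      = -(rho lam x * deriv (deriv (u t)) x) * u t x := by ring
    _ ≤ (1 / K t + A) * u t x := mul_le_mul_of_nonneg_right hkey hu0
    _ ≤ (1 / K t + A) * (u t x + 1 / (n:ℝ)) := by gcongr; linarith
end
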